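/- The assignment sending a quadratic refinement Q of β to the map L_Q : G_β → ZMod 4 defined by L_Q (w, p) = e w + Q p is a bijection from the set of quadratic refinements of β onto the set of additive group homomorphisms L : G_β →+ ZMod 4 satisfying L (w, 0) = e w for all w : ZMod 2. (This is the abstract form of the paper's Claim 3.2: quadratic functions on a Pin manifold M correspond bijectively to linear functions on G^{pin}_n(M, ∂M) that restrict to (1/2)∫ w on the subgroup of pairs (w, 0).) -/

import Mathlib

variable {V : Type*} [AddCommGroup V] [Module (ZMod 2) V]

/-- The group `G_β` of the paper: underlying set `(ZMod 2) × V` with twisted addition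
`(w, p) + (v, q) = (w + v + β p q, p + q)`. -/
@[ext]
structure GPin (β : V →ₗ[ZMod 2] V →ₗ[ZMod 2] ZMod 2)
    (hβ : ∀ x y : V, β x y = β y x) where
  w : ZMod 2
  p : V

namespace GPin

variable {β : V →ₗ[ZMod 2] V →ₗ[ZMod 2] ZMod 2} {hβ : ∀ x y : V, β x y = β y x}

theorem add_self_V (x : V) : x + x = 0 := by
  calc x + x = (1 : ZMod 2) • x + (1 : ZMod 2) • x := by rw [one_smul]
    _ = ((1 : ZMod 2) + 1) • x := (add_smul _ _ _).symm
    _ = (0 : ZMod 2) • x := by rw [show (1 : ZMod 2) + 1 = 0 from by decide]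
    _ = 0 := zero_smul _ _

instance : Add (GPin β hβ) := ⟨fun a b => ⟨a.w + b.w + β a.p b.p, a.p + b.p⟩⟩
instance : Zero (GPin β hβ) := ⟨⟨0, 0⟩⟩
instance : Neg (GPin β hβ) := ⟨fun a => ⟨a.w + β a.p a.p, a.p⟩⟩

theorem add_def (a b : GPin β hβ) :
    a + b = ⟨a.w + b.w + β a.p b.p, a.p + b.p⟩ := rfl
theorem zero_def : (0 : GPin β hβ) = ⟨0, 0⟩ := rfl
theorem neg_def (a : GPin β hβ) : -a = ⟨a.w + β a.p a.p, a.p⟩ := rfl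

theorem gadd_assoc (a b c : GPin β hβ) : a + b + c = a + (b + c) := by
  ext
  · simp only [add_def, map_add, LinearMap.add_apply]
    ring
  · simp only [add_def]
    exact add_assoc _ _ _

theorem gzero_add (a : GPin β hβ) : 0 + a = a := by
  ext <;> simp [add_def, zero_def]

theorem gadd_zero (a : GPin β hβ) : a + 0 = a := by
  ext <;> simp [add_def, zero_def]

theorem gadd_comm (a b : GPin β hβ) : a + b = b + a := by
  ext
  · simp only [add_def]
    rw [hβ b.p a.p]
    ring
  · simp only [add_def]
    exact add_comm _ _

theorem gneg_add_cancel (a : GPin β hβ) : -a + a = 0 := by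
  ext
  · simp only [add_def, neg_def, zero_def]
    generalize a.w = u
    generalize β a.p a.p = v
    revert u v
    decide
  · simp only [add_def, neg_def, zero_def]
    exact add_self_V _

instance : AddCommGroup (GPin β hβ) where
  add := (· + ·)
  zero := 0
  neg := Neg.neg
  add_assoc := gadd_assoc
  zero_add := gzero_add
  add_zero := gadd_zero
  add_comm := gadd_comm
  neg_add_cancel := gneg_add_cancel
  nsmul := nsmulRec
  zsmul := zsmulRec

end GPin

/-- `Q : V → ZMod 4` is a quadratic refinement of the symmetric bilinear form `β`,
where `e : ZMod 2 →+ ZMod 4` is the unique injective additive homomorphism. -/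
def IsQuadraticRefinement (β : V →ₗ[ZMod 2] V →ₗ[ZMod 2] ZMod 2)
    (e : ZMod 2 →+ ZMod 4) (Q : V → ZMod 4) : Prop :=
  ∀ x y : V, Q (x + y) = Q x + Q y + e (β x y)

/-- A pair `(w, p)` splits as `(w, 0) + (0, p)`. -/
theorem GPin.mk_eq_add {β : V →ₗ[ZMod 2] V →ₗ[ZMod 2] ZMod 2}
    {hβ : ∀ x y : V, β x y = β y x} (w : ZMod 2) (p : V) :
    (⟨w, p⟩ : GPin β hβ) = ⟨w, 0⟩ + ⟨0, p⟩ := by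
  ext <;> simp [GPin.add_def]

/-- An additive function on `GPin β hβ` extending `e` restricts to a quadratic refinement
of `β` along the section `p ↦ (0, p)`. -/
theorem IsQuadraticRefinement.of_additive {β : V →ₗ[ZMod 2] V →ₗ[ZMod 2] ZMod 2}
    {hβ : ∀ x y : V, β x y = β y x} {e : ZMod 2 →+ ZMod 4} {L : GPin β hβ → ZMod 4}
    (hadd : ∀ a b, L (a + b) = L a + L b) (hL : ∀ w : ZMod 2, L ⟨w, 0⟩ = e w) :
    IsQuadraticRefinement β e (fun p => L ⟨0, p⟩) := by
  intro x y
  have hsum : (⟨0, x⟩ + ⟨0, y⟩ : GPin β hβ) = ⟨β x y, 0⟩ + ⟨0, x + y⟩ := by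
    ext <;> simp [GPin.add_def]
  have hLsum := congrArg L hsum
  rw [hadd, hadd, hL] at hLsum
  have htwo : e (β x y) + e (β x y) = 0 := by
    rw [← map_add, CharTwo.add_self_eq_zero, map_zero]
  linear_combination -hLsum - htwo

/-- Claim 3.2 of the paper (abstract form): `Q ↦ L_Q` with `L_Q (w, p) = e w + Q p` is a
bijection from quadratic refinements of `β` onto additive group homomorphisms
`L : G_β → ZMod 4` with `L (w, 0) = e w`. -/
theorem quadraticRefinements_equiv_linear_functions_on_GPin
    (β : V →ₗ[ZMod 2] V →ₗ[ZMod 2] ZMod 2) (hβ : ∀ x y : V, β x y = β y x)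
    (e : ZMod 2 →+ ZMod 4) (he : Function.Injective e) (he1 : e 1 = 2) :
    Set.BijOn (fun (Q : V → ZMod 4) => (fun a : GPin β hβ => e a.w + Q a.p))
      {Q : V → ZMod 4 | IsQuadraticRefinement β e Q}
      {L : GPin β hβ → ZMod 4 |
        (∀ a b : GPin β hβ, L (a + b) = L a + L b) ∧
        ∀ w : ZMod 2, L ⟨w, 0⟩ = e w} := by
  refine ⟨fun Q hQ => ⟨fun a b => ?_, fun w => ?_⟩, fun Q _ Q' _ h => ?_, fun L hL => ?_⟩
  · simp only [GPin.add_def, map_add, hQ a.p b.p]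
    have htwo : e (β a.p b.p) + e (β a.p b.p) = 0 := by
      rw [← map_add, CharTwo.add_self_eq_zero, map_zero]
    linear_combination htwo
  · have hzero : Q 0 = 0 := by simpa using hQ 0 0
    simp [hzero]
  · funext p
    simpa using congrFun h ⟨0, p⟩
  · refine ⟨fun p => L ⟨0, p⟩, .of_additive hL.1 hL.2, funext fun a => ?_⟩
    change e a.w + L ⟨0, a.p⟩ = L ⟨a.w, a.p⟩
    rw [GPin.mk_eq_add a.w a.p, hL.1, hL.2]
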